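/- Let ξ = exp(2πi/11), ν = (−1+i√11)/2, ℤ[ν] = {a + bν : a, b ∈ ℤ} ⊂ ℂ, for k ∈ ℤ let v_k = (ξ^k, ξ^{9k}, ξ^{3k}, ξ^{4k}, ξ^{5k}) ∈ ℂ⁵, and let Λ₀ = ℤ[ν]v₀ + ℤ[ν]v₁ + ℤ[ν]v₂ + ℤ[ν]v₃ + ℤ[ν]v₄ and Λ₄ = Σ_{k=0}^{3} (ℤ[ν]/(1+2ν))(v_k − v_{k+1}) + ℤ[ν]v₀. Then Λ₀ ⊆ Λ₄, 11·Λ₄ ⊆ Λ₀, and the quotient group Λ₄/Λ₀ is isomorphic to (ℤ/11ℤ)⁴; in particular the index [Λ₄ : Λ₀] equals 11⁴, and the classes of (v₀−v₁)/(1+2ν), (v₁−v₂)/(1+2ν), (v₂−v₃)/(1+2ν), (v₃−v₄)/(1+2ν) form a basis of Λ₄/Λ₀ as a vector space over the field ℤ[ν]/(1+2ν) ≅ 𝔽₁₁. -/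

import Mathlib

/-- ξ = exp(2πi/11), a primitive 11th root of unity. -/
noncomputable def ξ : ℂ := Complex.exp (2 * Real.pi * Complex.I / 11)

/-- ν = (−1 + i√11)/2. -/
noncomputable def ν : ℂ := (-1 + Complex.I * Real.sqrt 11) / 2

/-- ℤ[ν] = {a + bν : a, b ∈ ℤ} ⊂ ℂ. -/
noncomputable def Zν : Set ℂ := {z | ∃ a b : ℤ, z = (a : ℂ) + (b : ℂ) * ν}

/-- v_k = (ξ^k, ξ^{9k}, ξ^{3k}, ξ^{4k}, ξ^{5k}) ∈ ℂ⁵. -/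
noncomputable def v (k : ℕ) : Fin 5 → ℂ := fun i => ξ ^ (k * ![1, 9, 3, 4, 5] i)

/-- t_k = (v_k − v_{k+1})/(1+2ν). -/
noncomputable def t (k : ℕ) : Fin 5 → ℂ := (1 / (1 + 2 * ν)) • (v k - v (k + 1))

/-- Λ₀ = ℤ[ν]v₀ + ℤ[ν]v₁ + ℤ[ν]v₂ + ℤ[ν]v₃ + ℤ[ν]v₄, as an additive subgroup of ℂ⁵. -/
noncomputable def Λ₀ : AddSubgroup (Fin 5 → ℂ) :=
  AddSubgroup.closure {x | ∃ c ∈ Zν, ∃ k : Fin 5, x = c • v k.val}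

/-- Λ₄ = Σ_{k=0}^{3} (ℤ[ν]/(1+2ν))(v_k − v_{k+1}) + ℤ[ν]v₀, as an additive subgroup of ℂ⁵. -/
noncomputable def Λ₄ : AddSubgroup (Fin 5 → ℂ) :=
  AddSubgroup.closure
    ({x | ∃ c ∈ Zν, ∃ k : Fin 4, x = c • t k.val} ∪ {x | ∃ c ∈ Zν, x = c • v 0})

theorem nu_quadratic : ν * ν = -ν - 3 := by
  have h : (Real.sqrt 11 : ℂ) * Real.sqrt 11 = 11 := by
    rw [← Complex.ofReal_mul, Real.mul_self_sqrt (by norm_num)]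
    norm_num
  unfold ν
  linear_combination (Real.sqrt 11 * Real.sqrt 11 / 4 : ℂ) * Complex.I_mul_I - 1 / 4 * h

theorem one_add_two_nu_sq : (1 + 2 * ν) * (1 + 2 * ν) = -11 := by
  linear_combination 4 * nu_quadratic

theorem one_add_two_nu_ne_zero : (1 + 2 * ν) ≠ 0 := by
  intro h
  have := one_add_two_nu_sq
  rw [h] at this
  norm_num at this

theorem one_add_two_nu_smul_t (k : ℕ) : (1 + 2 * ν) • t k = v k - v (k + 1) := by
  rw [t, smul_smul, mul_one_div_cancel one_add_two_nu_ne_zero, one_smul]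

theorem nu_im_ne_zero : ν.im ≠ 0 := by
  have h : ν.im = Real.sqrt 11 / 2 := by
    rw [show ν = ((-1 / 2 : ℝ) : ℂ) + ((Real.sqrt 11 / 2 : ℝ) : ℂ) * Complex.I by
      unfold ν; push_cast; ring]
    simp
  rw [h]
  positivity

theorem isPrimitiveRoot_xi : IsPrimitiveRoot ξ 11 := by
  have := Complex.isPrimitiveRoot_exp 11 (by norm_num)
  simpa [ξ] using this

/-- The embedding `(a, b) ↦ a + bν` of `ℤ²` onto `ℤ[ν]`. -/
noncomputable def evalNu : ℤ × ℤ →+ ℂ where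
  toFun p := p.1 + p.2 * ν
  map_zero' := by simp
  map_add' p q := by simp; ring

theorem evalNu_apply (p : ℤ × ℤ) : evalNu p = p.1 + p.2 * ν := rfl

theorem evalNu_mem (p : ℤ × ℤ) : evalNu p ∈ Zν := ⟨p.1, p.2, rfl⟩

theorem exists_evalNu_eq {c : ℂ} (hc : c ∈ Zν) : ∃ p, evalNu p = c := by
  obtain ⟨a, b, rfl⟩ := hc
  exact ⟨(a, b), rfl⟩

theorem evalNu_eq_zero {p : ℤ × ℤ} (h : evalNu p = 0) : p = 0 := by
  have him := congrArg Complex.im h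
  have h2 : p.2 = 0 := by
    simpa [evalNu_apply, nu_im_ne_zero] using him
  have h1 : p.1 = 0 := by simpa [evalNu_apply, h2] using h
  exact Prod.ext h1 h2

/-- Reduction of `ℤ[ν]` modulo `1 + 2ν`, under which `ν ↦ 5`. -/
def residue : ℤ × ℤ →+ ZMod 11 where
  toFun p := p.1 + 5 * p.2
  map_zero' := by simp
  map_add' p q := by simp; ring

theorem residue_apply (p : ℤ × ℤ) : residue p = p.1 + 5 * p.2 := rfl

/-- Multiplication by `1 + 2ν` in the coordinates `(a, b)` of `a + bν`. -/
def mulOneAddTwoNu (p : ℤ × ℤ) : ℤ × ℤ := (p.1 - 6 * p.2, 2 * p.1 - p.2)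

theorem evalNu_mulOneAddTwoNu (p : ℤ × ℤ) : evalNu (mulOneAddTwoNu p) = evalNu p * (1 + 2 * ν) := by
  simp only [evalNu_apply, mulOneAddTwoNu]
  push_cast
  linear_combination -2 * (p.2 : ℂ) * nu_quadratic

theorem residue_eq_zero_iff (p : ℤ × ℤ) : residue p = 0 ↔ ∃ q, p = mulOneAddTwoNu q := by
  have h : residue p = ((p.1 + 5 * p.2 : ℤ) : ZMod 11) := by
    rw [residue_apply]; push_cast; rfl
  rw [h, ZMod.intCast_zmod_eq_zero_iff_dvd]
  constructor
  · rintro ⟨m, hm⟩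
    push_cast at hm
    refine ⟨(p.2 - m, p.2 - 2 * m), Prod.ext ?_ ?_⟩ <;> simp only [mulOneAddTwoNu] <;> omega
  · rintro ⟨q, rfl⟩
    refine ⟨q.1 - q.2, ?_⟩
    simp only [mulOneAddTwoNu]
    push_cast
    ring

theorem residue_mulOneAddTwoNu (p : ℤ × ℤ) : residue (mulOneAddTwoNu p) = 0 :=
  (residue_eq_zero_iff _).2 ⟨p, rfl⟩

theorem linearIndependent_v : LinearIndependent ℂ fun k : Fin 5 => v k := by
  rw [Fintype.linearIndependent_iff]
  intro d hd
  have hdet : (Matrix.vandermonde fun i : Fin 5 => ξ ^ (![1, 9, 3, 4, 5] i : ℕ)).det ≠ 0 := by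
    rw [Matrix.det_vandermonde_ne_zero_iff]
    intro i j hij
    have := isPrimitiveRoot_xi.pow_inj (by fin_cases i <;> simp) (by fin_cases j <;> simp) hij
    revert this
    fin_cases i <;> fin_cases j <;> simp
  refine congrFun (Matrix.eq_zero_of_mulVec_eq_zero hdet (v := d) ?_)
  ext i
  have := congrFun hd i
  simp only [Finset.sum_apply, Pi.smul_apply, smul_eq_mul, v] at this
  simp only [Matrix.mulVec, dotProduct, Matrix.vandermonde_apply]
  rw [← this]
  refine Finset.sum_congr rfl fun k _ => ?_
  rw [← pow_mul, mul_comm, mul_comm (k : ℕ)]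

theorem coeff_eq_zero_of_sum_t_add_v {c : Fin 4 → ℂ} {d : ℂ}
    (h : ∑ k, c k • t k + d • v 0 = 0) : c = 0 ∧ d = 0 := by
  have hv := Fintype.linearIndependent_iff.1 linearIndependent_v
    ![c 0 + (1 + 2 * ν) * d, c 1 - c 0, c 2 - c 1, c 3 - c 2, -c 3] (by
      have h' := congrArg (fun x => (1 + 2 * ν) • x) h
      simp only [smul_add, Finset.smul_sum, smul_zero, smul_comm (1 + 2 * ν) (c _),
        one_add_two_nu_smul_t] at h'
      rw [← h']
      simp only [Fin.sum_univ_succ, Fin.sum_univ_zero]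
      simp
      module)
  have h0 := hv 0
  have h1 := hv 1
  have h2 := hv 2
  have h3 := hv 3
  have h4 := hv 4
  simp at h0 h1 h2 h3 h4
  have e2 : c 2 = 0 := by linear_combination h4 - h3
  have e1 : c 1 = 0 := by linear_combination e2 - h2
  have e0 : c 0 = 0 := by linear_combination e1 - h1
  refine ⟨?_, ?_⟩
  · ext k
    fin_cases k <;> simp [*]
  · rw [e0, zero_add] at h0
    exact (mul_eq_zero.1 h0).resolve_left one_add_two_nu_ne_zero

/-- The parametrization of `Λ₄` by the coordinates with respect to `t₀, t₁, t₂, t₃, v₀`. -/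
noncomputable def param : (Fin 4 → ℤ × ℤ) × (ℤ × ℤ) →+ (Fin 5 → ℂ) where
  toFun m := ∑ k, evalNu (m.1 k) • t k + evalNu m.2 • v 0
  map_zero' := by simp
  map_add' m n := by
    simp only [Prod.fst_add, Prod.snd_add, Pi.add_apply, map_add, add_smul,
      Finset.sum_add_distrib]
    abel

theorem param_apply (m : (Fin 4 → ℤ × ℤ) × (ℤ × ℤ)) :
    param m = ∑ k, evalNu (m.1 k) • t k + evalNu m.2 • v 0 := rfl

theorem param_injective : Function.Injective param := by
  rw [injective_iff_map_eq_zero]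
  intro m hm
  obtain ⟨h1, h2⟩ := coeff_eq_zero_of_sum_t_add_v hm
  exact Prod.ext (funext fun k => evalNu_eq_zero (congrFun h1 k)) (evalNu_eq_zero h2)

theorem range_param : param.range = Λ₄ := by
  apply le_antisymm
  · rintro _ ⟨m, rfl⟩
    rw [param_apply]
    refine add_mem (sum_mem fun k _ => ?_) ?_
    · exact AddSubgroup.subset_closure (Or.inl ⟨_, evalNu_mem _, k, rfl⟩)
    · exact AddSubgroup.subset_closure (Or.inr ⟨_, evalNu_mem _, rfl⟩)
  · refine (AddSubgroup.closure_le _).2 ?_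
    rintro _ (⟨c, hc, k, rfl⟩ | ⟨c, hc, rfl⟩) <;> obtain ⟨p, rfl⟩ := exists_evalNu_eq hc
    · refine ⟨(Pi.single k p, 0), ?_⟩
      rw [param_apply, Finset.sum_eq_single k] <;> simp +contextual
    · exact ⟨(0, p), by simp [param_apply]⟩

/-- The residues modulo `1 + 2ν` of the coordinates at `t₀, t₁, t₂, t₃`. -/
def residues : (Fin 4 → ℤ × ℤ) × (ℤ × ℤ) →+ (Fin 4 → ZMod 11) where
  toFun m k := residue (m.1 k)
  map_zero' := by ext; simp
  map_add' m n := by ext; simp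

theorem residues_apply (m : (Fin 4 → ℤ × ℤ) × (ℤ × ℤ)) (k : Fin 4) :
    residues m k = residue (m.1 k) := rfl

theorem smul_v_mem (p : ℤ × ℤ) (k : Fin 5) : evalNu p • v k ∈ Λ₀ :=
  AddSubgroup.subset_closure ⟨_, evalNu_mem _, k, rfl⟩

theorem map_ker_residues : residues.ker.map param = Λ₀ := by
  apply le_antisymm
  · rintro _ ⟨m, hm, rfl⟩
    rw [param_apply]
    refine add_mem (sum_mem fun k _ => ?_) (smul_v_mem _ 0)
    obtain ⟨q, hq⟩ := (residue_eq_zero_iff _).1 (congrFun hm k)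
    rw [hq, evalNu_mulOneAddTwoNu, mul_smul, one_add_two_nu_smul_t, smul_sub]
    exact sub_mem (smul_v_mem q k.castSucc) (smul_v_mem q k.succ)
  · refine (AddSubgroup.closure_le _).2 ?_
    rintro _ ⟨c, hc, k, rfl⟩
    obtain ⟨p, rfl⟩ := exists_evalNu_eq hc
    refine ⟨(fun j => if j.castSucc < k then -mulOneAddTwoNu p else 0, p), ?_, ?_⟩
    · ext j
      rw [residues_apply]
      dsimp only
      split_ifs <;> simp [residue_mulOneAddTwoNu]
    · have h (j : ℕ) : evalNu (-mulOneAddTwoNu p) • t j = evalNu p • (v (j + 1) - v j) := by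
        rw [map_neg, evalNu_mulOneAddTwoNu, neg_smul, mul_smul, one_add_two_nu_smul_t]
        module
      rw [param_apply]
      simp only [apply_ite evalNu, ite_smul, h, map_zero, zero_smul, Fin.sum_univ_succ,
        Fin.sum_univ_zero]
      fin_cases k <;> simp [Fin.lt_def] <;> module

theorem residues_surjective : Function.Surjective residues := by
  intro n
  refine ⟨(fun k => ((n k).val, 0), 0), ?_⟩
  ext k
  simp [residues_apply, residue_apply]

theorem param_mem_iff (m : (Fin 4 → ℤ × ℤ) × (ℤ × ℤ)) : param m ∈ Λ₀ ↔ residues m = 0 := by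
  rw [← map_ker_residues, AddSubgroup.mem_map_iff_mem param_injective, AddMonoidHom.mem_ker]

/-- `Λ₄` is isomorphic to its module of coordinates. -/
noncomputable def paramEquiv : (Fin 4 → ℤ × ℤ) × (ℤ × ℤ) ≃+ Λ₄ :=
  (AddMonoidHom.ofInjective param_injective).trans (AddEquiv.addSubgroupCongr range_param)

theorem coe_paramEquiv (m : (Fin 4 → ℤ × ℤ) × (ℤ × ℤ)) : (paramEquiv m : Fin 5 → ℂ) = param m :=
  rfl

theorem ker_residues_comp_symm :
    (residues.comp paramEquiv.symm.toAddMonoidHom).ker = Λ₀.addSubgroupOf Λ₄ := by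
  ext x
  obtain ⟨m, rfl⟩ := paramEquiv.surjective x
  rw [AddSubgroup.mem_addSubgroupOf, coe_paramEquiv, param_mem_iff, AddMonoidHom.mem_ker]
  simp

theorem residues_comp_symm_surjective :
    Function.Surjective (residues.comp paramEquiv.symm.toAddMonoidHom) :=
  residues_surjective.comp paramEquiv.symm.surjective

theorem param_sub_sum_mem_iff (m : (Fin 4 → ℤ × ℤ) × (ℤ × ℤ)) (n : Fin 4 → Fin 11) :
    param m - ∑ k : Fin 4, ((n k : ℕ) : ℂ) • t k.val ∈ Λ₀ ↔
      n = fun k => ⟨(residues m k).val, ZMod.val_lt _⟩ := by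
  have h : ∑ k : Fin 4, ((n k : ℕ) : ℂ) • t k.val = param (fun k => ((n k : ℕ), 0), 0) := by
    simp [param_apply, evalNu_apply]
  rw [h, ← map_sub, param_mem_iff, map_sub, sub_eq_zero, funext_iff, funext_iff]
  refine forall_congr' fun k => ?_
  have hk : residues (fun k => ((n k : ℕ), 0), 0) k = ((n k : ℕ) : ZMod 11) := by
    simp [residues_apply, residue_apply]
  rw [hk, Fin.ext_iff, ← (ZMod.val_injective 11).eq_iff, ZMod.val_cast_of_lt (n k).isLt, eq_comm]

/-- Λ₀ ⊆ Λ₄, 11·Λ₄ ⊆ Λ₀, the quotient Λ₄/Λ₀ is isomorphic to (ℤ/11ℤ)⁴, the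
index [Λ₄ : Λ₀] is 11⁴, and the classes of t₀, t₁, t₂, t₃ form a basis of Λ₄/Λ₀ over 𝔽₁₁
(every element of Λ₄ is, uniquely mod Λ₀, an 𝔽₁₁-combination of t₀, …, t₃). -/
theorem quotient_Lambda4_Lambda0 :
    Λ₀ ≤ Λ₄ ∧
    (∀ x ∈ Λ₄, (11 : ℤ) • x ∈ Λ₀) ∧
    Nonempty ((Λ₄ ⧸ Λ₀.addSubgroupOf Λ₄) ≃+ (Fin 4 → ZMod 11)) ∧
    (Λ₀.addSubgroupOf Λ₄).index = 11 ^ 4 ∧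
    (∀ x ∈ Λ₄, ∃! n : Fin 4 → Fin 11,
      x - ∑ k : Fin 4, ((n k : ℕ) : ℂ) • t k.val ∈ Λ₀) := by
  refine ⟨?_, ?_, ?_, ?_, ?_⟩
  · rw [← map_ker_residues, ← range_param]
    rintro _ ⟨m, -, rfl⟩
    exact ⟨m, rfl⟩
  · rw [← range_param]
    rintro _ ⟨m, rfl⟩
    rw [← map_zsmul, param_mem_iff, map_zsmul]
    ext k
    simp only [Pi.smul_apply, zsmul_eq_mul, Pi.zero_apply]
    rw [show ((11 : ℤ) : ZMod 11) = 0 from rfl, zero_mul]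
  · rw [← ker_residues_comp_symm]
    exact ⟨QuotientAddGroup.quotientKerEquivOfSurjective _ residues_comp_symm_surjective⟩
  · rw [← ker_residues_comp_symm, AddSubgroup.index_ker,
      AddMonoidHom.range_eq_top.2 residues_comp_symm_surjective]
    simp
  · rw [← range_param]
    rintro _ ⟨m, rfl⟩
    simp only [param_sub_sum_mem_iff]
    exact existsUnique_eq
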